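/- Let A be a (possibly infinite) geometrically fast set of positive bump functions in Homeo₊(I), equipped with a marking witnessing fastness. Suppose s, t ∈ I both have trivial history and lie in the supports of exactly the same elements of A (that is, {a ∈ A : s ∈ supt(a)} = {a ∈ A : t ∈ supt(a)}). Then every return word for s is a return word for t. Moreover, if w is a nonempty word which is not a return word for s, then there is a ∈ A^± such that both sw ∈ dest(a) and tw ∈ dest(a). -/

import Mathlib

open Set

/-- The unit interval `[0,1]` as a type. -/
abbrev UI : Type := ↥unitInterval

/-- Bijections of the unit interval; orientation-preserving homeomorphisms are
exactly the monotone ones among these. -/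
abbrev Homeo01 : Type := Equiv.Perm UI

namespace PingPong

/-- The support of `f`. -/
def supt (f : Homeo01) : Set UI := {t | f t ≠ t}

/-- `f` is an orientation-preserving homeomorphism of `[0,1]`:
a monotone bijection of `[0,1]` (automatically a homeomorphism). -/
def IsOPH (f : Homeo01) : Prop := Monotone ⇑f

/-- A bump function: an orientation preserving homeomorphism with exactly one
orbital, i.e. whose support is nonempty and connected. -/
def IsBump (f : Homeo01) : Prop := IsOPH f ∧ IsConnected (supt f)

/-- A positive bump function. -/
def IsPosBump (f : Homeo01) : Prop := IsBump f ∧ ∀ t ∈ supt f, t < f t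

/-- The source of a positive bump `a` with marker `t`. -/
def src (a : Homeo01) (t : UI) : Set UI := {s ∈ supt a | s < t}

/-- The destination of a positive bump `a` with marker `t`. -/
def dest (a : Homeo01) (t : UI) : Set UI := {s ∈ supt a | a t ≤ s}

/-- `m` is a marking of the collection `A` of bumps. -/
def IsMarking (A : Set Homeo01) (m : Homeo01 → UI) : Prop := ∀ a ∈ A, m a ∈ supt a

/-- The feet of a marked bump: `false` gives the source, `true` the destination. -/
def foot (a : Homeo01) (t : UI) : Bool → Set UI
  | false => src a t
  | true => dest a t

/-- The feet of the marked family `(A, m)` are pairwise disjoint. -/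
def FeetDisjoint (A : Set Homeo01) (m : Homeo01 → UI) : Prop :=
  ∀ a ∈ A, ∀ b ∈ A, ∀ i j : Bool, (a, i) ≠ (b, j) →
    Disjoint (foot a (m a) i) (foot b (m b) j)

/-- A geometrically fast collection of (positive) bumps. -/
def FastBumps (A : Set Homeo01) : Prop :=
  (∀ a ∈ A, IsPosBump a) ∧ ∃ m : Homeo01 → UI, IsMarking A m ∧ FeetDisjoint A m

/-- `t` is a left transition point of `f`. -/
def IsLeftTransition (f : Homeo01) (t : UI) : Prop :=
  t ∉ supt f ∧ ∀ ε : ℝ, 0 < ε → ∃ s ∈ supt f, t < s ∧ (s : ℝ) < (t : ℝ) + ε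

/-- `t` is a right transition point of `f`. -/
def IsRightTransition (f : Homeo01) (t : UI) : Prop :=
  t ∉ supt f ∧ ∀ ε : ℝ, 0 < ε → ∃ s ∈ supt f, s < t ∧ (t : ℝ) - ε < (s : ℝ)

/-- `t` is a transition point of `f`. -/
def IsTransition (f : Homeo01) (t : UI) : Prop :=
  IsLeftTransition f t ∨ IsRightTransition f t

/-- A geometrically proper set of homeomorphisms. -/
def GeomProper (X : Set Homeo01) : Prop :=
  (∀ f ∈ X, ∀ g ∈ X, f ≠ g → ∀ t : UI, ¬(IsLeftTransition f t ∧ IsLeftTransition g t)) ∧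
  (∀ f ∈ X, ∀ g ∈ X, f ≠ g → ∀ t : UI, ¬(IsRightTransition f t ∧ IsRightTransition g t))

/-- The positive bump `a` is used in `f`. -/
def UsedIn (f a : Homeo01) : Prop :=
  IsPosBump a ∧ (Set.EqOn ⇑f ⇑a (supt a) ∨ Set.EqOn ⇑f ⇑a⁻¹ (supt a))

/-- The set of (positive) bumps used in `X`. -/
def usedBumps (X : Set Homeo01) : Set Homeo01 := {a | ∃ f ∈ X, UsedIn f a}

/-- A geometrically fast set of homeomorphisms. -/
def GeomFast (X : Set Homeo01) : Prop := GeomProper X ∧ FastBumps (usedBumps X)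

/-- The set of transition points of elements of `X`. -/
def transitionPoints (X : Set Homeo01) : Set UI := {t | ∃ f ∈ X, IsTransition f t}

/-! ### Words -/

/-- A word in the alphabet `A^± = A ∪ A⁻¹`, recorded as a list of the permutations
represented by its symbols (for a set `A` of positive bumps this is faithful,
since `A ∩ A⁻¹ = ∅`). -/
def WordOn (A : Set Homeo01) (w : List Homeo01) : Prop := ∀ x ∈ w, x ∈ A ∨ x⁻¹ ∈ A

/-- A freely reduced word: no symbol is immediately followed by its inverse. -/
def FreelyReduced (w : List Homeo01) : Prop := List.Chain' (fun a b => b ≠ a⁻¹) w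

/-- The right action of a word on a point: apply the symbols from left to right. -/
def act (t : UI) (w : List Homeo01) : UI := w.foldl (fun s a => a s) t

/-- `w` is locally reduced at `t`. -/
def LocallyReducedAt (w : List Homeo01) (t : UI) : Prop :=
  FreelyReduced w ∧ ∀ (u : List Homeo01) (a : Homeo01), u ++ [a] <+: w → a (act t u) ≠ act t u

open Classical in
/-- The source of a symbol of `A^±`: for `a ∈ A` it is `src a`, and for the
formal inverse of an element of `A` it is the destination of that element. -/
noncomputable def symSrc (A : Set Homeo01) (m : Homeo01 → UI) (b : Homeo01) : Set UI :=
  if b ∈ A then src b (m b) else dest b⁻¹ (m b⁻¹)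

open Classical in
/-- The destination of a symbol of `A^±`. -/
noncomputable def symDest (A : Set Homeo01) (m : Homeo01 → UI) (b : Homeo01) : Set UI :=
  if b ∈ A then dest b (m b) else src b⁻¹ (m b⁻¹)

/-- The source of a word: the source of its first symbol (empty for the empty word). -/
noncomputable def wordSrc (A : Set Homeo01) (m : Homeo01 → UI) : List Homeo01 → Set UI
  | [] => ∅
  | a :: _ => symSrc A m a

/-- The destination of a word: the destination of its last symbol. -/
noncomputable def wordDest (A : Set Homeo01) (m : Homeo01 → UI) (w : List Homeo01) : Set UI :=
  match w.getLast? with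
  | none => ∅
  | some a => symDest A m a

/-- `J(w) = supt(a) \ src(a)` where `a` is the first symbol of `w`. -/
noncomputable def Jset (A : Set Homeo01) (m : Homeo01 → UI) : List Homeo01 → Set UI
  | [] => ∅
  | a :: _ => supt a \ symSrc A m a

/-- `t` has trivial history: it lies in no foot of any element of `A`. -/
def TrivialHistory (A : Set Homeo01) (m : Homeo01 → UI) (t : UI) : Prop :=
  ∀ a ∈ A, t ∉ src a (m a) ∧ t ∉ dest a (m a)

/-- `x` has finite history: there is a finite bound on the lengths of `A`-words
locally reduced at `x` whose evaluation at `x` is outside their destination. -/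
def FiniteHistory (A : Set Homeo01) (m : Homeo01 → UI) (x : UI) : Prop :=
  ∃ n : ℕ, ∀ w : List Homeo01, WordOn A w → LocallyReducedAt w x →
    act x w ∉ wordDest A m w → w.length ≤ n

/-- A return word for `x`. -/
def IsReturnWord (x : UI) (w : List Homeo01) : Prop := w ≠ [] ∧ act x w = x

/-- `w` has a return prefix for `x`. -/
def HasReturnPrefix (x : UI) (w : List Homeo01) : Prop :=
  ∃ v : List Homeo01, v <+: w ∧ IsReturnWord x v

/-- The set of initial markers of the marked family `(A, m)`. -/
def initialMarkers (A : Set Homeo01) (m : Homeo01 → UI) : Set UI :=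
  {t | (∃ a ∈ A, m a = t) ∧ ∀ b ∈ A, m b < t → b (m b) ≠ t}

/-- `M⟨X⟩`: the orbit of the set of initial markers of `(A, m)` under the group
generated by `X`. -/
def MOrbit (A : Set Homeo01) (m : Homeo01 → UI) (X : Set Homeo01) : Set UI :=
  {u | ∃ t ∈ initialMarkers A m, ∃ g ∈ Subgroup.closure X, g t = u}

end PingPong
namespace PingPong

/-! ### Piecewise linear maps and Thompson's group F -/

/-- `f` is piecewise linear (finitely many affine pieces). -/
def IsPL (f : Homeo01) : Prop :=
  ∃ (n : ℕ) (t : Fin (n + 1) → ℝ), StrictMono t ∧ t 0 = 0 ∧ t (Fin.last n) = 1 ∧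
    ∀ i : Fin n, ∃ c d : ℝ, ∀ s : UI,
      t i.castSucc ≤ (s : ℝ) → (s : ℝ) ≤ t i.succ → ((f s : ℝ)) = c * (s : ℝ) + d

/-- `x` is a dyadic rational. -/
def IsDyadic (x : ℝ) : Prop := ∃ (a : ℤ) (k : ℕ), x = (a : ℝ) / 2 ^ k

/-- `f` belongs to Thompson's group `F`: an orientation-preserving piecewise linear
homeomorphism of `[0,1]` with dyadic breakpoints and slopes integer powers of `2`. -/
def InThompsonF (f : Homeo01) : Prop :=
  IsOPH f ∧
  ∃ (n : ℕ) (t : Fin (n + 1) → ℝ), StrictMono t ∧ t 0 = 0 ∧ t (Fin.last n) = 1 ∧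
    (∀ i, IsDyadic (t i)) ∧
    ∀ i : Fin n, ∃ (k : ℤ) (d : ℝ), ∀ s : UI,
      t i.castSucc ≤ (s : ℝ) → (s : ℝ) ≤ t i.succ → ((f s : ℝ)) = (2 : ℝ) ^ k * (s : ℝ) + d

/-! ### Stretched transition chains -/

/-- `a` is isolated in `A`: its support contains no transition point of an element of `A`. -/
def IsolatedIn (A : Set Homeo01) (a : Homeo01) : Prop :=
  ∀ t ∈ supt a, ∀ b ∈ A, ¬ IsTransition b t

/-- `c` (with supports `(x i, y i)`) is a stretched transition chain of `A`. -/
def IsSTC (A : Set Homeo01) (k : ℕ) (c : Fin (k + 1) → Homeo01)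
    (x y : Fin (k + 1) → ℝ) : Prop :=
  (∀ i, c i ∈ A ∧ ¬ IsolatedIn A (c i)) ∧
  (∀ i, supt (c i) = {t : UI | x i < (t : ℝ) ∧ (t : ℝ) < y i}) ∧
  (∀ i : Fin k, x i.castSucc < x i.succ ∧ x i.succ < y i.castSucc ∧ y i.castSucc < y i.succ) ∧
  (∀ i : Fin k, ∀ t : UI, x i.succ < (t : ℝ) → (t : ℝ) < y i.castSucc →
    ∀ b ∈ A, ¬ IsTransition b t)

/-- `S` is the underlying set of some stretched transition chain of `A`. -/
def ChainSet (A : Set Homeo01) (S : Set Homeo01) : Prop :=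
  ∃ (k : ℕ) (c : Fin (k + 1) → Homeo01) (x y : Fin (k + 1) → ℝ),
    IsSTC A k c x y ∧ S = Set.range c

/-- `S` is the underlying set of a maximal stretched transition chain of `A`. -/
def MaxChainSet (A : Set Homeo01) (S : Set Homeo01) : Prop :=
  ChainSet A S ∧ ∀ S' : Set Homeo01, ChainSet A S' → S ⊆ S' → S = S'

/-- The transition points of `A` lying in the support of the chain `c`. -/
def chainTrans (A : Set Homeo01) (k : ℕ) (c : Fin (k + 1) → Homeo01) : Set UI :=
  {t | (∃ i, t ∈ supt (c i)) ∧ ∃ b ∈ A, IsTransition b t}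

/-- The image of `t` under the composition `∏ C = c 0 ⋯ c k`. -/
def chainApply (k : ℕ) (c : Fin (k + 1) → Homeo01) (t : UI) : UI :=
  (List.ofFn c).foldl (fun s a => a s) t

/-! ### Dynamical diagrams -/

/-- The collection of feet of the bumps used in `X`, with marking `m`. -/
def Feet (X : Set Homeo01) (m : Homeo01 → UI) : Set (Set UI) :=
  {S | ∃ a ∈ usedBumps X, S = src a (m a) ∨ S = dest a (m a)}

/-- The signed bumps of `f`: bumps agreeing with `f` on their support. -/
def signedBumps (f : Homeo01) : Set Homeo01 :=
  {b | IsBump b ∧ Set.EqOn ⇑b ⇑f (supt b)}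

open Classical in
/-- The source of a signed bump, with respect to the marking `m` of the positive bumps. -/
noncomputable def sSrc (m : Homeo01 → UI) (b : Homeo01) : Set UI :=
  if IsPosBump b then src b (m b) else dest b⁻¹ (m b⁻¹)

open Classical in
/-- The destination of a signed bump, with respect to the marking `m` of the positive bumps. -/
noncomputable def sDest (m : Homeo01 → UI) (b : Homeo01) : Set UI :=
  if IsPosBump b then dest b (m b) else src b⁻¹ (m b⁻¹)

/-- An isomorphism of the dynamical diagrams of the marked families `(X, mX)` and
`(Y, mY)`, inducing the bijection `τ : X → Y`: an order-preserving bijection `Φ`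
between the collections of feet, together with, for each `f ∈ X`, a bijection of the
signed bumps of `f` with those of `τ f` under which `Φ` matches sources with sources
and destinations with destinations. -/
def DiagIso (X : Set Homeo01) (mX : Homeo01 → UI) (Y : Set Homeo01) (mY : Homeo01 → UI)
    (τ : Homeo01 → Homeo01) : Prop :=
  Set.BijOn τ X Y ∧
  ∃ Φ : Set UI → Set UI,
    Set.BijOn Φ (Feet X mX) (Feet Y mY) ∧
    (∀ S ∈ Feet X mX, ∀ T ∈ Feet X mX,
      (∀ s ∈ S, ∀ t ∈ T, s < t) → ∀ s ∈ Φ S, ∀ t ∈ Φ T, s < t) ∧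
    ∀ f ∈ X, ∃ β : Homeo01 → Homeo01,
      Set.BijOn β (signedBumps f) (signedBumps (τ f)) ∧
      ∀ b ∈ signedBumps f, Φ (sSrc mX b) = sSrc mY (β b) ∧ Φ (sDest mX b) = sDest mY (β b)

/-! ### Excision -/

/-- The union of the supports of the bumps of `E` used in `f`. -/
def quotSupp (f : Homeo01) (E : Set Homeo01) : Set UI :=
  {t | ∃ a ∈ E, UsedIn f a ∧ t ∈ supt a}

/-- `g = f/E`: `g` is the identity on the supports of the bumps of `E` used in `f`,
and agrees with `f` elsewhere. -/
def IsQuot (f : Homeo01) (E : Set Homeo01) (g : Homeo01) : Prop :=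
  (∀ t ∈ quotSupp f E, g t = t) ∧ ∀ t ∉ quotSupp f E, g t = f t

/-- `E` is extraneous in `X` (with respect to the marking `m`), witnessed by an
interval `J`. -/
def Extraneous (X : Set Homeo01) (m : Homeo01 → UI) (E : Set Homeo01) : Prop :=
  ∃ J : Set UI, J.OrdConnected ∧ ∃ f ∈ X,
    (∀ e ∈ E, UsedIn f e ∧ IsolatedIn (usedBumps X) e ∧ supt e ⊆ J) ∧
    (∃ a : Homeo01, UsedIn f a ∧ a ∉ E ∧ (src a (m a) ⊆ J ∨ dest a (m a) ⊆ J)) ∧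
    ∀ g ∈ X, g ≠ f → ∀ b : Homeo01, UsedIn g b →
      Disjoint (src b (m b)) J ∧ Disjoint (dest b (m b)) J

end PingPong
namespace PingPong

theorem mem_supt {f : Homeo01} {p : UI} : p ∈ supt f ↔ f p ≠ p := Iff.rfl

theorem apply_inv_apply (f : Homeo01) (p : UI) : f (f⁻¹ p) = p := f.apply_symm_apply p

theorem supt_inv (f : Homeo01) : supt f⁻¹ = supt f := by
  ext p
  rw [mem_supt, mem_supt, ne_eq, Equiv.Perm.inv_eq_iff_eq, eq_comm]

theorem apply_mem_supt {f : Homeo01} {p : UI} : f p ∈ supt f ↔ p ∈ supt f := by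
  simp only [mem_supt, ne_eq, f.injective.eq_iff]

theorem inv_apply_mem_supt {f : Homeo01} {p : UI} : f⁻¹ p ∈ supt f ↔ p ∈ supt f := by
  rw [← apply_mem_supt, apply_inv_apply]

theorem act_append (p : UI) (u v : List Homeo01) : act p (u ++ v) = act (act p u) v :=
  List.foldl_append

section Bump

variable {a : Homeo01} {p q : UI}

theorem IsPosBump.strictMono (ha : IsPosBump a) : StrictMono a :=
  ha.1.1.strictMono_of_injective a.injective

theorem IsPosBump.ordConnected_supt (ha : IsPosBump a) : (supt a).OrdConnected :=
  ha.1.2.isPreconnected.ordConnected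

theorem IsPosBump.lt_apply (ha : IsPosBump a) (hp : p ∈ supt a) : p < a p := ha.2 p hp

theorem IsPosBump.inv_apply_lt (ha : IsPosBump a) (hp : p ∈ supt a) : a⁻¹ p < p := by
  simpa using ha.lt_apply (inv_apply_mem_supt.2 hp)

theorem IsPosBump.not_inv (ha : IsPosBump a) : ¬ IsPosBump a⁻¹ := by
  intro h
  obtain ⟨p, hp⟩ := ha.1.2.nonempty
  exact lt_asymm (ha.inv_apply_lt hp) (h.lt_apply (by rwa [supt_inv]))

theorem foot_subset_supt (a : Homeo01) (t : UI) (i : Bool) : foot a t i ⊆ supt a := by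
  cases i <;> exact fun _ h => h.1

theorem IsPosBump.ordConnected_foot (ha : IsPosBump a) (t : UI) (i : Bool) :
    (foot a t i).OrdConnected := by
  have := ha.ordConnected_supt
  cases i
  · exact this.inter ordConnected_Iio
  · exact this.inter ordConnected_Ici

/-- An order-connected set that contains both a point of the support and a point outside it
meets a foot. -/
theorem IsPosBump.exists_mem_foot (ha : IsPosBump a) {t : UI} (ht : t ∈ supt a) {S : Set UI}
    (hS : S.OrdConnected) (hpS : p ∈ S) (hqS : q ∈ S) (hp : p ∈ supt a) (hq : q ∉ supt a) :
    ∃ i, ∃ r ∈ S, r ∈ foot a t i := by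
  have hfix : a q = q := not_not.1 hq
  have hmono := ha.strictMono
  have hconn := ha.ordConnected_supt
  rcases lt_trichotomy q p with hqp | rfl | hpq
  · have hqt : q < t := by
      by_contra! h
      exact hq (hconn.out ht hp ⟨h, hqp.le⟩)
    have hmem : min t p ∈ supt a := by rcases min_choice t p with h | h <;> rwa [h]
    have hlt := ha.inv_apply_lt hmem
    have hqr : q < a⁻¹ (min t p) := by
      rw [← hmono.lt_iff_lt, hfix, apply_inv_apply]
      exact lt_min hqt hqp
    exact ⟨false, _, hS.out hqS hpS ⟨hqr.le, (hlt.trans_le (min_le_right _ _)).le⟩,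
      inv_apply_mem_supt.2 hmem, hlt.trans_le (min_le_left _ _)⟩
  · exact absurd hp hq
  · have htq : t < q := by
      by_contra! h
      exact hq (hconn.out hp ht ⟨hpq.le, h⟩)
    have hmem : max t p ∈ supt a := by rcases max_choice t p with h | h <;> rwa [h]
    have hlt := ha.lt_apply hmem
    have hrq : a (max t p) < q := by
      rw [← hfix, hmono.lt_iff_lt]
      exact max_lt htq hpq
    exact ⟨true, _, hS.out hpS hqS ⟨((le_max_right _ _).trans_lt hlt).le, hrq.le⟩,
      apply_mem_supt.2 hmem, hmono.monotone (le_max_left _ _)⟩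

end Bump

section Symbols

variable {A : Set Homeo01} {m : Homeo01 → UI} {b x : Homeo01} {p q : UI}

theorem symDest_of_mem (hb : b ∈ A) : symDest A m b = foot b (m b) true := if_pos hb

theorem symDest_inv_of_mem (hA : ∀ a ∈ A, IsPosBump a) (hb : b ∈ A) :
    symDest A m b⁻¹ = foot b (m b) false := by
  have : b⁻¹ ∉ A := fun h => (hA b hb).not_inv (hA _ h)
  simp [symDest, this, foot]

/-- Every symbol of `A^±` is an element of `A` up to inversion, and its destination is the
corresponding foot. -/
theorem exists_foot_of_symbol (hA : ∀ a ∈ A, IsPosBump a) (m : Homeo01 → UI)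
    (hb : b ∈ A ∨ b⁻¹ ∈ A) :
    ∃ a ∈ A, ∃ i : Bool, b = cond i a a⁻¹ ∧ symDest A m b = foot a (m a) i := by
  rcases hb with hb | hb
  · exact ⟨b, hb, true, rfl, symDest_of_mem hb⟩
  · refine ⟨b⁻¹, hb, false, (inv_inv b).symm, ?_⟩
    simpa using symDest_inv_of_mem (m := m) hA hb

theorem supt_cond_inv (a : Homeo01) (i : Bool) : supt (cond i a a⁻¹) = supt a := by
  cases i
  · exact supt_inv a
  · rfl

theorem TrivialHistory.notMem_symDest (hA : ∀ a ∈ A, IsPosBump a) (hp : TrivialHistory A m p)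
    (hb : b ∈ A ∨ b⁻¹ ∈ A) : p ∉ symDest A m b := by
  obtain ⟨a, ha, i, -, h⟩ := exists_foot_of_symbol hA m hb
  rw [h]
  cases i
  · exact (hp a ha).1
  · exact (hp a ha).2

/-- A symbol maps the part of its support outside its source into its destination. -/
theorem apply_mem_symDest (hA : ∀ a ∈ A, IsPosBump a) (hb : b ∈ A ∨ b⁻¹ ∈ A)
    (hp : p ∈ supt b) (hsrc : p ∉ symDest A m b⁻¹) : b p ∈ symDest A m b := by
  rcases hb with hb | hb
  · rw [symDest_inv_of_mem hA hb] at hsrc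
    rw [symDest_of_mem hb]
    refine ⟨apply_mem_supt.2 hp, (hA b hb).strictMono.monotone ?_⟩
    by_contra! h
    exact hsrc ⟨hp, h⟩
  · rw [symDest_of_mem hb] at hsrc
    rw [← inv_inv b, symDest_inv_of_mem hA hb, inv_inv]
    rw [← supt_inv] at hp
    have hlt : p < b⁻¹ (m b⁻¹) := by
      by_contra! h
      exact hsrc ⟨hp, h⟩
    refine ⟨by rwa [supt_inv, apply_mem_supt, ← supt_inv], ?_⟩
    rw [← (hA _ hb).strictMono.lt_iff_lt]
    simpa using hlt

theorem notMem_symDest_of_ne (hA : ∀ a ∈ A, IsPosBump a) (hfd : FeetDisjoint A m)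
    (hb : b ∈ A ∨ b⁻¹ ∈ A) (hx : x ∈ A ∨ x⁻¹ ∈ A) (hne : x ≠ b) (hp : p ∈ symDest A m x) :
    p ∉ symDest A m b := by
  obtain ⟨a, ha, i, rfl, ha'⟩ := exists_foot_of_symbol hA m hb
  obtain ⟨c, hc, j, rfl, hc'⟩ := exists_foot_of_symbol hA m hx
  rw [hc'] at hp
  rw [ha']
  refine (hfd c hc a ha j i fun h => hne ?_).notMem_of_mem_left hp
  simp only [Prod.mk.injEq] at h
  rw [h.1, h.2]

/-- The destination of a symbol is either contained in or disjoint from the support of any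
other symbol. -/
theorem mem_supt_of_mem_symDest (hA : ∀ a ∈ A, IsPosBump a) (hm : IsMarking A m)
    (hfd : FeetDisjoint A m) (hb : b ∈ A ∨ b⁻¹ ∈ A) (hx : x ∈ A ∨ x⁻¹ ∈ A)
    (hp : p ∈ symDest A m x) (hq : q ∈ symDest A m x) (hpb : p ∈ supt b) : q ∈ supt b := by
  obtain ⟨a, ha, i, rfl, -⟩ := exists_foot_of_symbol hA m hb
  obtain ⟨c, hc, j, -, hx'⟩ := exists_foot_of_symbol hA m hx
  rw [hx'] at hp hq
  rw [supt_cond_inv] at hpb ⊢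
  by_cases hca : c = a
  · exact hca ▸ foot_subset_supt _ _ _ hq
  by_contra hqb
  obtain ⟨k, r, hr, hr'⟩ := (hA a ha).exists_mem_foot (hm a ha)
    ((hA c hc).ordConnected_foot (m c) j) hp hq hpb hqb
  exact (hfd c hc a ha j k (by simp [hca])).notMem_of_mem_left hr hr'

/-- Pairs of points reached from `(s, t)` by pushing both coordinates along the same symbols,
each step taking both coordinates into the destination of its symbol. -/
inductive Fellows (A : Set Homeo01) (m : Homeo01 → UI) (s t : UI) : UI → UI → Prop
  | base : Fellows A m s t s t
  | push {p q : UI} {x : Homeo01} : Fellows A m s t p q → (x ∈ A ∨ x⁻¹ ∈ A) →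
      x p ∈ symDest A m x → x q ∈ symDest A m x → Fellows A m s t (x p) (x q)

variable {s t : UI}

theorem Fellows.eq_or_mem_symDest (h : Fellows A m s t p q) :
    (p = s ∧ q = t) ∨
      ∃ x : Homeo01, (x ∈ A ∨ x⁻¹ ∈ A) ∧ p ∈ symDest A m x ∧ q ∈ symDest A m x := by
  cases h with
  | base => exact .inl ⟨rfl, rfl⟩
  | push _ hx hp hq => exact .inr ⟨_, hx, hp, hq⟩

theorem Fellows.apply_of_notMem (hA : ∀ a ∈ A, IsPosBump a) (h : Fellows A m s t p q)
    (hb : b ∈ A ∨ b⁻¹ ∈ A) (hpq : p ∈ supt b ↔ q ∈ supt b)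
    (hp : p ∉ symDest A m b⁻¹) (hq : q ∉ symDest A m b⁻¹) : Fellows A m s t (b p) (b q) := by
  by_cases hpb : p ∈ supt b
  · exact h.push hb (apply_mem_symDest hA hb hpb hp) (apply_mem_symDest hA hb (hpq.1 hpb) hq)
  · have hqb : q ∉ supt b := fun h => hpb (hpq.2 h)
    rwa [not_not.1 hpb, not_not.1 hqb]

theorem Fellows.apply (hA : ∀ a ∈ A, IsPosBump a) (hm : IsMarking A m)
    (hfd : FeetDisjoint A m) (hs : TrivialHistory A m s) (ht : TrivialHistory A m t)
    (hsame : ∀ a ∈ A, (s ∈ supt a ↔ t ∈ supt a)) (h : Fellows A m s t p q)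
    (hb : b ∈ A ∨ b⁻¹ ∈ A) : Fellows A m s t (b p) (b q) := by
  have hb' : b⁻¹ ∈ A ∨ b⁻¹⁻¹ ∈ A := by rw [inv_inv]; exact hb.symm
  cases h with
  | base =>
    refine Fellows.base.apply_of_notMem hA hb ?_ (hs.notMem_symDest hA hb')
      (ht.notMem_symDest hA hb')
    rcases hb with hb | hb
    · exact hsame b hb
    · rw [← supt_inv]; exact hsame _ hb
  | @push p q x h hx hp hq =>
    by_cases hxb : x = b⁻¹
    · subst hxb
      simpa using h
    · exact (h.push hx hp hq).apply_of_notMem hA hb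
        ⟨mem_supt_of_mem_symDest hA hm hfd hb hx hp hq,
          mem_supt_of_mem_symDest hA hm hfd hb hx hq hp⟩
        (notMem_symDest_of_ne hA hfd hb' hx hxb hp) (notMem_symDest_of_ne hA hfd hb' hx hxb hq)

theorem Fellows.of_wordOn (hA : ∀ a ∈ A, IsPosBump a) (hm : IsMarking A m)
    (hfd : FeetDisjoint A m) (hs : TrivialHistory A m s) (ht : TrivialHistory A m t)
    (hsame : ∀ a ∈ A, (s ∈ supt a ↔ t ∈ supt a)) {w : List Homeo01} (hw : WordOn A w) :
    Fellows A m s t (act s w) (act t w) := by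
  induction w using List.reverseRecOn with
  | nil => exact .base
  | append_singleton u b ih =>
    rw [act_append, act_append]
    exact (ih fun x hx => hw x (by simp [hx])).apply hA hm hfd hs ht hsame (hw b (by simp))

end Symbols

/-- **Lemma (FellowTraveler3).** For a geometrically fast marked set `A` of positive
bumps: if `s, t` have trivial history and lie in the supports of exactly the same
elements of `A`, then every return word for `s` is a return word for `t`; moreover,
if the nonempty `A`-word `w` is not a return word for `s`, then `sw` and `tw` lie in
the destination of a common symbol `a ∈ A^±`. -/
theorem fellow_traveler_three (A : Set Homeo01) (m : Homeo01 → UI)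
    (hA : ∀ a ∈ A, IsPosBump a) (hm : IsMarking A m) (hfd : FeetDisjoint A m)
    (s t : UI) (hs : TrivialHistory A m s) (ht : TrivialHistory A m t)
    (hsame : ∀ a ∈ A, (s ∈ supt a ↔ t ∈ supt a)) :
    (∀ w : List Homeo01, WordOn A w → IsReturnWord s w → IsReturnWord t w) ∧
    (∀ w : List Homeo01, WordOn A w → w ≠ [] → ¬ IsReturnWord s w →
      ∃ a : Homeo01, (a ∈ A ∨ a⁻¹ ∈ A) ∧
        act s w ∈ symDest A m a ∧ act t w ∈ symDest A m a) := by
  refine ⟨fun w hw hret => ?_, fun w hw hne hret => ?_⟩ <;>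
    rcases (Fellows.of_wordOn hA hm hfd hs ht hsame hw).eq_or_mem_symDest with
      ⟨hsw, htw⟩ | ⟨x, hx, hsx, htx⟩
  · exact ⟨hret.1, htw⟩
  · rw [hret.2] at hsx
    exact absurd hsx (hs.notMem_symDest hA hx)
  · exact absurd ⟨hne, hsw⟩ hret
  · exact ⟨x, hx, hsx, htx⟩

end PingPong
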